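/- For n ≥ 1, the map φ : S_{f_n} → S_{f_{n+2}} defined by φ(t) = t · \hat t_n t \hat t_n^{-1} (where S_{f_n} is viewed as the subgroup of S_{f_{n+2}} of permutations fixing all points greater than f_n) is an injective group homomorphism whose image is exactly the subgroup \tilde S_{f_n}; hence \tilde S_{f_n} is isomorphic to S_{f_n}. -/

import Mathlib

/-- The permutation `\hat t n = (1, f_{n+1}+1)(2, f_{n+1}+2)⋯(f_n, f_{n+1}+f_n)` of `ℕ`,
regarded as an element of the symmetric group on `{1,…,f_{n+2}}`. -/
def hatt (n : ℕ) : Equiv.Perm ℕ :=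
  ((List.range (Nat.fib n)).map (fun i => Equiv.swap (i + 1) (Nat.fib (n + 1) + (i + 1)))).prod

/-- The permutations `t k n` of the paper, defined recursively by `t n n = \hat t n`,
`t (n-1) n = t (n-1) (n-1)` and `t k n = t k (n-1) * (\hat t n * t k (n-2) * (\hat t n)⁻¹)`
for `k ≤ n - 2`. -/
def tperm (k : ℕ) : ℕ → Equiv.Perm ℕ
  | 0 => 1
  | 1 => hatt 1
  | (n + 2) =>
      if k = n + 2 then hatt (n + 2)
      else if k = n + 1 then tperm k (n + 1)
      else tperm k (n + 1) * (hatt (n + 2) * tperm k n * (hatt (n + 2))⁻¹)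

/-- The symmetric group on `{1,…,m}`, as the subgroup of `Equiv.Perm ℕ` of permutations fixing
every point outside `{1,…,m}`. -/
def symOn (m : ℕ) : Subgroup (Equiv.Perm ℕ) where
  carrier := {g | ∀ i ∉ Finset.Icc 1 m, g i = i}
  one_mem' := fun i _ => rfl
  mul_mem' := by
    intro a b ha hb i hi
    have := hb i hi
    have := ha i hi
    simp only [Equiv.Perm.mul_apply]
    rw [hb i hi, ha i hi]
  inv_mem' := by
    intro a ha i hi
    conv_lhs => rw [← ha i hi]
    simp

/-- The set `\tilde S_{f_n}`: elements `g` of the symmetric group on `{1,…,f_{n+2}}` such that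
`g (i + f_{n+1}) = g i + f_{n+1}` for `1 ≤ i ≤ f_n` and `g i = i` for `f_n < i ≤ f_{n+1}`. -/
def tildeSet (n : ℕ) : Set (Equiv.Perm ℕ) :=
  {g | (∀ i ∉ Finset.Icc 1 (Nat.fib (n + 2)), g i = i) ∧
    (∀ i ∈ Finset.Icc 1 (Nat.fib n), g (i + Nat.fib (n + 1)) = g i + Nat.fib (n + 1)) ∧
    (∀ i, Nat.fib n < i → i ≤ Nat.fib (n + 1) → g i = i)}

/-- The set `G_n = {t k n : 1 ≤ k ≤ n}`. -/
def Gset (n : ℕ) : Set (Equiv.Perm ℕ) := {σ | ∃ k, 1 ≤ k ∧ k ≤ n ∧ σ = tperm k n}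

/-- The set `G'_n = {t k n : 1 ≤ k ≤ n - 2}`. -/
def G'set (n : ℕ) : Set (Equiv.Perm ℕ) := {σ | ∃ k, 1 ≤ k ∧ k ≤ n - 2 ∧ σ = tperm k n}

theorem prod_swap_add_apply (m k : ℕ) (hk : k ≤ m) (x : ℕ) :
    ((List.range k).map (fun i => Equiv.swap (i + 1) (m + (i + 1)))).prod x =
      if 1 ≤ x ∧ x ≤ k then x + m else if m < x ∧ x ≤ m + k then x - m else x := by
  induction k generalizing x with
  | zero =>
    simp only [List.range_zero, List.map_nil, List.prod_nil, Equiv.Perm.one_apply]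
    grind
  | succ k ih =>
    rw [List.range_succ, List.map_append, List.prod_append, Equiv.Perm.mul_apply,
      ih (by omega)]
    simp only [List.map_cons, List.map_nil, List.prod_singleton, Equiv.swap_apply_def]
    grind

theorem hatt_apply (n x : ℕ) :
    hatt n x = if 1 ≤ x ∧ x ≤ Nat.fib n then x + Nat.fib (n + 1)
      else if Nat.fib (n + 1) < x ∧ x ≤ Nat.fib (n + 1) + Nat.fib n then x - Nat.fib (n + 1)
      else x :=
  prod_swap_add_apply _ _ Nat.fib_le_fib_succ x

theorem hatt_inv (n : ℕ) : (hatt n)⁻¹ = hatt n := by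
  rw [inv_eq_iff_mul_eq_one]
  ext x
  have := @Nat.fib_le_fib_succ n
  simp only [Equiv.Perm.mul_apply, hatt_apply, Equiv.Perm.one_apply]
  grind

theorem apply_mem_Icc_of_mem_symOn {m : ℕ} {t : Equiv.Perm ℕ} (ht : t ∈ symOn m) {x : ℕ}
    (hx : x ∈ Finset.Icc 1 m) : t x ∈ Finset.Icc 1 m := by
  by_contra h
  have := t.injective (ht _ h)
  rw [this] at h
  exact h hx

/-- Conjugation by `hatt n` moves `t` to the block above `fib (n + 1)`, so the product acts as `t`
on each of the two blocks. -/
theorem mul_conj_hatt_apply {n : ℕ} {t : Equiv.Perm ℕ} (ht : t ∈ symOn (Nat.fib n)) (x : ℕ) :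
    (t * (hatt n * t * (hatt n)⁻¹)) x =
      if x ≤ Nat.fib (n + 1) then t x else t (x - Nat.fib (n + 1)) + Nat.fib (n + 1) := by
  have hle := @Nat.fib_le_fib_succ n
  have hin : ∀ y, 1 ≤ y → y ≤ Nat.fib n → 1 ≤ t y ∧ t y ≤ Nat.fib n := fun y h₁ h₂ =>
    Finset.mem_Icc.1 (apply_mem_Icc_of_mem_symOn ht (Finset.mem_Icc.2 ⟨h₁, h₂⟩))
  have hout : ∀ y, ¬(1 ≤ y ∧ y ≤ Nat.fib n) → t y = y := fun y h =>
    ht y (by rwa [Finset.mem_Icc])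
  simp only [Equiv.Perm.mul_apply, hatt_inv]
  rw [hatt_apply n x]
  split_ifs with h₁ h₂ h₂ h₃ h₃
  · rw [hout (x + _) (by omega), hatt_apply]
    congr 1
    grind
  · omega
  · omega
  · have := hin (x - Nat.fib (n + 1)) (by omega) (by omega)
    rw [hatt_apply, if_pos this, hout _ (by omega)]
  · rw [hout x h₁, hatt_apply, if_neg h₁, if_neg h₂, hout x h₁]
  · rw [hout x h₁, hatt_apply, if_neg h₁, if_neg h₂, hout x h₁, hout _ (by omega)]
    omega

/-- The homomorphism `t ↦ t * (hatt n * t * (hatt n)⁻¹)`. -/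
def symOnDiag (n : ℕ) : symOn (Nat.fib n) →* Equiv.Perm ℕ :=
  MonoidHom.mk' (fun t => (t : Equiv.Perm ℕ) * (hatt n * (t : Equiv.Perm ℕ) * (hatt n)⁻¹)) <| by
    rintro ⟨s, hs⟩ ⟨t, ht⟩
    ext x
    have hle := @Nat.fib_le_fib_succ n
    have hin : ∀ y, 1 ≤ y → y ≤ Nat.fib n → 1 ≤ t y ∧ t y ≤ Nat.fib n := fun y h₁ h₂ =>
      Finset.mem_Icc.1 (apply_mem_Icc_of_mem_symOn ht (Finset.mem_Icc.2 ⟨h₁, h₂⟩))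
    have hout : ∀ y, ¬(1 ≤ y ∧ y ≤ Nat.fib n) → t y = y := fun y h =>
      ht y (by rwa [Finset.mem_Icc])
    change (s * t * (hatt n * (s * t) * (hatt n)⁻¹)) x =
      (s * (hatt n * s * (hatt n)⁻¹)) ((t * (hatt n * t * (hatt n)⁻¹)) x)
    rw [mul_conj_hatt_apply ((symOn _).mul_mem hs ht),
      mul_conj_hatt_apply ht, mul_conj_hatt_apply hs]
    simp only [Equiv.Perm.mul_apply]
    by_cases hx : x ≤ Nat.fib (n + 1)
    · have : t x ≤ Nat.fib (n + 1) := by grind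
      simp [hx, this]
    · have : 1 ≤ t (x - Nat.fib (n + 1)) := by grind
      rw [if_neg hx, if_neg hx, if_neg (by omega), Nat.add_sub_cancel]

theorem symOnDiag_apply {n : ℕ} (t : symOn (Nat.fib n)) :
    symOnDiag n t = (t : Equiv.Perm ℕ) * (hatt n * (t : Equiv.Perm ℕ) * (hatt n)⁻¹) := rfl

theorem symOnDiag_injective (n : ℕ) : Function.Injective (symOnDiag n) := by
  rintro ⟨s, hs⟩ ⟨t, ht⟩ h
  ext x
  have hle := @Nat.fib_le_fib_succ n
  by_cases hx : x ∈ Finset.Icc 1 (Nat.fib n)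
  · have := DFunLike.congr_fun h x
    have hx' : x ≤ Nat.fib (n + 1) := (Finset.mem_Icc.1 hx).2.trans hle
    rwa [symOnDiag_apply, symOnDiag_apply, mul_conj_hatt_apply hs, mul_conj_hatt_apply ht,
      if_pos hx', if_pos hx'] at this
  · exact (hs x hx).trans (ht x hx).symm

theorem symOnDiag_mem_tildeSet {n : ℕ} (t : symOn (Nat.fib n)) : symOnDiag n t ∈ tildeSet n := by
  obtain ⟨t, ht⟩ := t
  have hle := @Nat.fib_le_fib_succ n
  have hfib := @Nat.fib_add_two n
  have hout : ∀ y, ¬(1 ≤ y ∧ y ≤ Nat.fib n) → t y = y := fun y h =>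
    ht y (by rwa [Finset.mem_Icc])
  simp only [tildeSet, Set.mem_ofPred_eq, symOnDiag_apply, mul_conj_hatt_apply ht, Finset.mem_Icc]
  refine ⟨fun i hi => ?_, fun i hi => ?_, fun i h₁ h₂ => ?_⟩
  · split_ifs
    · exact hout i (by omega)
    · rw [hout _ (by omega)]
      omega
  · rw [if_neg (by omega), if_pos (by omega), Nat.add_sub_cancel]
  · rw [if_pos h₂, hout i (by omega)]

theorem apply_mem_Icc_iff_of_mem_tildeSet {n : ℕ} {g : Equiv.Perm ℕ} (hg : g ∈ tildeSet n)
    (x : ℕ) : g x ∈ Finset.Icc 1 (Nat.fib n) ↔ x ∈ Finset.Icc 1 (Nat.fib n) := by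
  obtain ⟨h₁, h₂, -⟩ := hg
  have hfib := @Nat.fib_add_two n
  have hmem : ∀ y ∈ Finset.Icc 1 (Nat.fib (n + 2)), g y ∈ Finset.Icc 1 (Nat.fib (n + 2)) :=
    fun y => apply_mem_Icc_of_mem_symOn (t := g) h₁
  have hmaps : ∀ y ∈ Finset.Icc 1 (Nat.fib n), g y ∈ Finset.Icc 1 (Nat.fib n) := by
    intro y hy
    have hy₂ := h₂ y hy
    rw [Finset.mem_Icc] at hy
    have := Finset.mem_Icc.1 (hmem y (Finset.mem_Icc.2 (by omega)))
    have := Finset.mem_Icc.1 (hmem (y + Nat.fib (n + 1)) (Finset.mem_Icc.2 (by omega)))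
    rw [Finset.mem_Icc]
    omega
  refine ⟨fun hx => ?_, hmaps x⟩
  simpa using Equiv.Perm.perm_symm_on_of_perm_on_finset hmaps hx

theorem exists_symOnDiag_eq {n : ℕ} {g : Equiv.Perm ℕ} (hg : g ∈ tildeSet n) :
    ∃ t, symOnDiag n t = g := by
  let s := Equiv.Perm.ofSubtype
    (g.subtypePerm (p := (· ∈ Finset.Icc 1 (Nat.fib n))) (apply_mem_Icc_iff_of_mem_tildeSet hg))
  have hs_mem : ∀ x ∈ Finset.Icc 1 (Nat.fib n), s x = g x := fun x hx =>
    Equiv.Perm.ofSubtype_apply_of_mem _ hx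
  have hs : s ∈ symOn (Nat.fib n) := fun x hx => Equiv.Perm.ofSubtype_apply_of_not_mem _ hx
  have hfib := @Nat.fib_add_two n
  obtain ⟨h₁, h₂, h₃⟩ := hg
  refine ⟨⟨s, hs⟩, Equiv.ext fun x => ?_⟩
  rw [symOnDiag_apply, mul_conj_hatt_apply hs]
  split_ifs with hx
  · by_cases hx' : x ∈ Finset.Icc 1 (Nat.fib n)
    · exact hs_mem x hx'
    · rw [hs x hx']
      rw [Finset.mem_Icc] at hx'
      by_cases h0 : x = 0
      · exact (h₁ x (by simp [h0])).symm
      · exact (h₃ x (by omega) hx).symm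
  · by_cases hx' : x - Nat.fib (n + 1) ∈ Finset.Icc 1 (Nat.fib n)
    · rw [hs_mem _ hx', ← h₂ _ hx', Nat.sub_add_cancel (by omega)]
    · rw [hs _ hx', h₁ x (by rw [Finset.mem_Icc] at hx' ⊢; omega)]
      omega

/-- For `n ≥ 1`, the map `φ(t) = t ⬝ \hat t_n t \hat t_n⁻¹` on the symmetric
group of `{1,…,f_n}` (viewed as permutations fixing all points outside `{1,…,f_n}`) is an
injective group homomorphism with image exactly `\tilde S_{f_n}`; hence `\tilde S_{f_n}` is
isomorphic to the symmetric group on `f_n` letters. -/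
theorem phi_injective_range_tildeSet (n : ℕ) (hn : 1 ≤ n) :
    ∃ φ : symOn (Nat.fib n) →* Equiv.Perm ℕ,
      (∀ t : symOn (Nat.fib n),
        φ t = (t : Equiv.Perm ℕ) * (hatt n * (t : Equiv.Perm ℕ) * (hatt n)⁻¹)) ∧
      Function.Injective φ ∧
      (↑φ.range : Set (Equiv.Perm ℕ)) = tildeSet n ∧
      Nonempty ((symOn (Nat.fib n)) ≃* φ.range) := by
  refine ⟨symOnDiag n, symOnDiag_apply, symOnDiag_injective n, ?_,
    ⟨MonoidHom.ofInjective (symOnDiag_injective n)⟩⟩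
  ext g
  constructor
  · rintro ⟨t, rfl⟩
    exact symOnDiag_mem_tildeSet t
  · exact exists_symOnDiag_eq
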